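/- arXiv:1812.07721 — 6 statements merged into one kernel-verified Lean document; each statement's English description precedes it below -/
import Mathlib

section
/- Let A and B be finite sets, let w : A × B → ℝ≥0 be edge weights, and let M₀ : A × B → ℝ be a fractional matching, i.e. 0 ≤ M₀(a,b) ≤ 1 for all (a,b), for every a ∈ A one has Σ_{b ∈ B} M₀(a,b) ≤ 1, and for every b ∈ B one has Σ_{a ∈ A} M₀(a,b) ≤ 1. Let W = Σ_{(a,b)} M₀(a,b)·w(a,b). Then there exists an integral matching M₁ : A × B → {0,1} (i.e. for every a, Σ_b M₁(a,b) ≤ 1 and for every b, Σ_a M₁(a,b) ≤ 1) such that: (i) every vertex u ∈ A ∪ B whose M₀-incidence sum equals 1 is matched in M₁ (its M₁-incidence sum equals 1); (ii) Σ_{(a,b)} M₁(a,b)·w(a,b) ≤ W; and (iii) M₁(a,b) = 1 implies M₀(a,b) ≠ 0. -/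
theorem fmr_aux {n : Type*} [Fintype n] [DecidableEq n] (D C : Matrix n n ℝ)
    (hD : D ∈ doublyStochastic ℝ n) :
    ∃ σ : Equiv.Perm n, (∀ i, D i (σ i) ≠ 0) ∧
      ∑ i, C i (σ i) ≤ ∑ i, ∑ j, D i j * C i j := by
  obtain ⟨v, hv0, hv1, hv⟩ := exists_eq_sum_perm_of_mem_doublyStochastic hD
  have hent : ∀ i j, D i j = ∑ σ : Equiv.Perm n, v σ * (if σ i = j then 1 else 0) := by
    intro i j
    rw [← hv, Matrix.sum_apply]
    refine Finset.sum_congr rfl fun σ _ => ?_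
    simp [Equiv.Perm.permMatrix, PEquiv.toMatrix_apply, Equiv.toPEquiv_apply]
  have hcost : ∑ i, ∑ j, D i j * C i j = ∑ σ : Equiv.Perm n, v σ * ∑ i, C i (σ i) := by
    simp_rw [hent, Finset.sum_mul, Finset.mul_sum]
    rw [Finset.sum_comm' (t' := Finset.univ) (s' := fun _ => Finset.univ) (by simp)]
    rw [Finset.sum_comm]
    simp_rw [fun i => Finset.sum_comm (s := (Finset.univ : Finset n)) (t := (Finset.univ : Finset (Equiv.Perm n))) (f := fun j σ => v σ * (if σ i = j then 1 else 0) * C i j)]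
    rw [Finset.sum_comm]
    simp
  by_contra! hcon
  have hpos : ∀ σ, 0 < v σ → ∀ i, D i (σ i) ≠ 0 := by
    intro σ hσ i
    apply ne_of_gt
    rw [hent]
    refine Finset.sum_pos' (fun τ _ => mul_nonneg (hv0 τ) (by split_ifs <;> norm_num)) ⟨σ, Finset.mem_univ _, by simpa using hσ⟩
  obtain ⟨σ₀, hσ₀⟩ : ∃ σ, 0 < v σ := by
    by_contra! h
    have := Finset.sum_nonpos (s := Finset.univ) (fun σ _ => h σ)
    linarith
  have : ∑ σ : Equiv.Perm n, v σ * (∑ i, ∑ j, D i j * C i j) < ∑ σ : Equiv.Perm n, v σ * ∑ i, C i (σ i) := by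
    refine Finset.sum_lt_sum (fun σ _ => ?_) ⟨σ₀, Finset.mem_univ _, ?_⟩
    · rcases (hv0 σ).eq_or_lt with h | h
      · simp [← h]
      · exact mul_le_mul_of_nonneg_left (hcon σ (hpos σ h)).le h.le
    · exact mul_lt_mul_of_pos_left (hcon σ₀ (hpos σ₀ hσ₀)) hσ₀
  rw [← Finset.sum_mul, hv1, one_mul, ← hcost] at this
  exact lt_irrefl _ this

open Finset in
/-- Rounding a weighted bipartite fractional matching to an integral matching
(Theorem 3). -/
theorem fractional_matching_rounding {A B : Type*} [Fintype A] [Fintype B]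
    (w : A → B → ℝ) (hw : ∀ a b, 0 ≤ w a b)
    (M₀ : A → B → ℝ)
    (hM₀0 : ∀ a b, 0 ≤ M₀ a b) (hM₀1 : ∀ a b, M₀ a b ≤ 1)
    (hA : ∀ a, (∑ b, M₀ a b) ≤ 1)
    (hB : ∀ b, (∑ a, M₀ a b) ≤ 1) :
    ∃ M₁ : A → B → ℝ,
      (∀ a b, M₁ a b = 0 ∨ M₁ a b = 1) ∧
      (∀ a, (∑ b, M₁ a b) ≤ 1) ∧
      (∀ b, (∑ a, M₁ a b) ≤ 1) ∧
      (∀ a, (∑ b, M₀ a b) = 1 → (∑ b, M₁ a b) = 1) ∧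
      (∀ b, (∑ a, M₀ a b) = 1 → (∑ a, M₁ a b) = 1) ∧
      (∑ a, ∑ b, M₁ a b * w a b) ≤ (∑ a, ∑ b, M₀ a b * w a b) ∧
      (∀ a b, M₁ a b = 1 → M₀ a b ≠ 0) := by
  classical
  let D : Matrix (A ⊕ B) (A ⊕ B) ℝ := Matrix.fromBlocks
    (Matrix.diagonal fun a => 1 - ∑ b, M₀ a b) (Matrix.of M₀) (Matrix.of M₀).transpose
    (Matrix.diagonal fun b => 1 - ∑ a, M₀ a b)
  let C : Matrix (A ⊕ B) (A ⊕ B) ℝ := Matrix.fromBlocks 0 (Matrix.of w) 0 0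
  have hD : D ∈ doublyStochastic ℝ (A ⊕ B) := by
    rw [mem_doublyStochastic_iff_sum]
    refine ⟨?_, ?_, ?_⟩
    · rintro (a | b) (a' | b')
      · simp only [D, Matrix.fromBlocks_apply₁₁, Matrix.diagonal_apply]
        split_ifs
        · linarith [hA a]
        · exact le_rfl
      · exact hM₀0 _ _
      · exact hM₀0 _ _
      · simp only [D, Matrix.fromBlocks_apply₂₂, Matrix.diagonal_apply]
        split_ifs
        · linarith [hB b]
        · exact le_rfl
    · rintro (a | b) <;> simp [D, Matrix.diagonal_apply]
    · rintro (a | b) <;> simp [D, Matrix.diagonal_apply]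
  obtain ⟨σ, hσ, hc⟩ := fmr_aux D C hD
  have key : ∀ a b, (if σ (Sum.inl a) = Sum.inr b then (1:ℝ) else 0) =
      if σ.symm (Sum.inr b) = Sum.inl a then 1 else 0 := by
    intro a b
    simp only [Equiv.symm_apply_eq]
    simp only [eq_comm]
  refine ⟨fun a b => if σ (Sum.inl a) = Sum.inr b then 1 else 0, ?_, ?_, ?_, ?_, ?_, ?_, ?_⟩
  · intro a b
    dsimp only
    split_ifs <;> simp
  · intro a
    rcases h : σ (Sum.inl a) with a' | b' <;> simp [h]
  · intro b
    simp only [key]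
    rcases h : σ.symm (Sum.inr b) with a' | b' <;> simp [h]
  · intro a ha
    have h2 := hσ (Sum.inl a)
    rcases h : σ (Sum.inl a) with a' | b'
    · rw [h] at h2
      simp [D, Matrix.diagonal_apply] at h2
      exact absurd (by linarith [ha]) h2.2
    · simp [h]
  · intro b hb
    simp only [key]
    have h2 := hσ (σ.symm (Sum.inr b))
    rw [Equiv.apply_symm_apply] at h2
    rcases h : σ.symm (Sum.inr b) with a' | b'
    · simp [h]
    · rw [h] at h2
      simp only [D, Matrix.fromBlocks_apply₂₂, Matrix.diagonal_apply] at h2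
      split_ifs at h2 with h3
      · subst h3
        exact absurd (by linarith [hb]) h2
      · exact absurd rfl h2
  · have e1 : ∑ i, ∑ j, D i j * C i j = ∑ a, ∑ b, M₀ a b * w a b := by
      simp [D, C]
    have e2 : ∑ i, C i (σ i) = ∑ a, ∑ b, (if σ (Sum.inl a) = Sum.inr b then 1 else 0) * w a b := by
      rw [Fintype.sum_sum_type]
      have : ∑ b, C (Sum.inr b) (σ (Sum.inr b)) = 0 := by
        refine Finset.sum_eq_zero fun b _ => ?_
        rcases σ (Sum.inr b) with a' | b' <;> simp [C]
      rw [this, add_zero]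
      refine Finset.sum_congr rfl fun a _ => ?_
      rcases h : σ (Sum.inl a) with a' | b' <;> simp [C]
    rw [e1, e2] at hc
    exact hc
  · intro a b h
    dsimp only at h
    split_ifs at h with h1
    · have h2 := hσ (Sum.inl a)
      rw [h1] at h2
      exact h2
    · norm_num at h
end

section
/- Let A and B be finite sets, let η' > 0 be a real number, let F : A × B → ℝ≥0 satisfy Σ_{b ∈ B} F(a,b) ≤ η' for every a ∈ A and Σ_{a ∈ A} F(a,b) ≤ η' for every b ∈ B, and let w : A × B → ℝ≥0 be edge weights. Call a vertex saturated if its total F-value equals η'. Then there exists a set M ⊆ A × B that is a matching (no two pairs of M share a coordinate) such that: (i) every saturated vertex of A and every saturated vertex of B belongs to some pair of M; (ii) Σ_{(a,b) ∈ M} w(a,b) ≤ (Σ_{(a,b)} F(a,b)·w(a,b)) / η'; and (iii) every pair (a,b) ∈ M satisfies F(a,b) > 0. -/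
open Finset in
/-- Rounding a capacitated flow into a matching of the saturated vertices
(Corollary 1). -/
theorem flow_rounding_matching {A B : Type*} [Fintype A] [Fintype B]
    (η' : ℝ) (hη : 0 < η')
    (F : A → B → ℝ) (hF : ∀ a b, 0 ≤ F a b)
    (hFA : ∀ a, (∑ b, F a b) ≤ η') (hFB : ∀ b, (∑ a, F a b) ≤ η')
    (w : A → B → ℝ) (hw : ∀ a b, 0 ≤ w a b) :
    ∃ M : Finset (A × B),
      (∀ x ∈ M, ∀ y ∈ M, x ≠ y → x.1 ≠ y.1 ∧ x.2 ≠ y.2) ∧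
      (∀ a, (∑ b, F a b) = η' → ∃ x ∈ M, x.1 = a) ∧
      (∀ b, (∑ a, F a b) = η' → ∃ x ∈ M, x.2 = b) ∧
      (∑ x ∈ M, w x.1 x.2) ≤ (∑ a, ∑ b, F a b * w a b) / η' ∧
      (∀ x ∈ M, 0 < F x.1 x.2) := by
  classical
  let D : Matrix (A ⊕ B) (A ⊕ B) ℝ := Matrix.fromBlocks
    (Matrix.diagonal fun a => 1 - (∑ b, F a b) / η') (Matrix.of fun a b => F a b / η')
    (Matrix.of fun b a => F a b / η') (Matrix.diagonal fun b => 1 - (∑ a, F a b) / η')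
  have hA1 : ∀ a, 0 ≤ 1 - (∑ b, F a b) / η' := fun a => by
    rw [sub_nonneg, div_le_one hη]; exact hFA a
  have hB1 : ∀ b, 0 ≤ 1 - (∑ a, F a b) / η' := fun b => by
    rw [sub_nonneg, div_le_one hη]; exact hFB b
  have hD : D ∈ doublyStochastic ℝ (A ⊕ B) := by
    rw [mem_doublyStochastic_iff_sum]
    refine ⟨?_, ?_, ?_⟩
    · rintro (a | b) (a' | b')
      · simp only [D, Matrix.fromBlocks_apply₁₁, Matrix.diagonal_apply]
        split_ifs
        · exact hA1 a
        · exact le_rfl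
      · exact div_nonneg (hF _ _) hη.le
      · exact div_nonneg (hF _ _) hη.le
      · simp only [D, Matrix.fromBlocks_apply₂₂, Matrix.diagonal_apply]
        split_ifs
        · exact hB1 b
        · exact le_rfl
    · rintro (a | b) <;> simp [D, Matrix.diagonal_apply, Finset.sum_div]
    · rintro (a | b) <;> simp [D, Matrix.diagonal_apply, Finset.sum_div]
  obtain ⟨c, hc0, hc1, hcD⟩ := exists_eq_sum_perm_of_mem_doublyStochastic hD
  have hent : ∀ i j, ∑ σ : Equiv.Perm (A ⊕ B), c σ * (if σ i = j then 1 else 0) = D i j := by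
    intro i j
    rw [← hcD, Matrix.sum_apply]
    refine Finset.sum_congr rfl fun σ _ => ?_
    simp [Equiv.toPEquiv_apply, PEquiv.toMatrix_apply]
  let cost : Equiv.Perm (A ⊕ B) → ℝ := fun σ =>
    ∑ a, ∑ b, (if σ (Sum.inl a) = Sum.inr b then 1 else 0) * w a b
  have hcost : ∑ σ, c σ * cost σ = (∑ a, ∑ b, F a b * w a b) / η' := by
    simp only [cost, Finset.mul_sum, Finset.sum_div]
    rw [Finset.sum_comm]
    refine Finset.sum_congr rfl fun a _ => ?_
    rw [Finset.sum_comm]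
    refine Finset.sum_congr rfl fun b _ => ?_
    simp only [← mul_assoc]
    rw [← Finset.sum_mul, hent]
    simp only [D, Matrix.fromBlocks_apply₁₂, Matrix.of_apply]
    ring
  obtain ⟨σ, hσ, hσc⟩ : ∃ σ, 0 < c σ ∧ cost σ ≤ (∑ a, ∑ b, F a b * w a b) / η' := by
    by_contra! h
    set C := (∑ a, ∑ b, F a b * w a b) / η'
    have h0 : ∑ σ, c σ * (cost σ - C) = 0 := by
      simp only [mul_sub, Finset.sum_sub_distrib]
      rw [hcost, ← Finset.sum_mul, hc1]; ring
    have h1 := (Finset.sum_eq_zero_iff_of_nonneg (fun σ _ => by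
      rcases (hc0 σ).eq_or_lt with h2 | h2
      · simp [← h2]
      · exact mul_nonneg h2.le (sub_nonneg.2 (h σ h2).le))).1 h0
    have h2 : ∀ σ, c σ = 0 := fun σ => by
      by_contra h3
      have h4 := (hc0 σ).lt_of_ne' h3
      exact (mul_pos h4 (sub_pos.2 (h σ h4))).ne' (h1 σ (Finset.mem_univ _))
    simp [h2] at hc1
  have hpos : ∀ i j, σ i = j → 0 < D i j := by
    intro i j hij
    rw [← hent]
    refine Finset.sum_pos' (fun τ _ => mul_nonneg (hc0 τ) (by split_ifs <;> norm_num))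
      ⟨σ, Finset.mem_univ _, by simpa [hij] using hσ⟩
  refine ⟨Finset.univ.filter fun x => σ (Sum.inl x.1) = Sum.inr x.2, ?_, ?_, ?_, ?_, ?_⟩
  · rintro ⟨a, b⟩ hx ⟨a', b'⟩ hy hne
    simp only [Finset.mem_filter, Finset.mem_univ, true_and] at hx hy
    constructor
    · rintro (rfl : a = a')
      rw [hx] at hy
      exact hne (by rw [Sum.inr.inj hy])
    · rintro (rfl : b = b')
      exact hne (by rw [Sum.inl.inj (σ.injective (hx.trans hy.symm))])
  · intro a ha
    rcases h : σ (Sum.inl a) with a' | b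
    · have := hpos _ _ h
      simp only [D, Matrix.fromBlocks_apply₁₁, Matrix.diagonal_apply, ha, div_self hη.ne'] at this
      simp at this
    · exact ⟨(a, b), by simpa using h, rfl⟩
  · intro b hb
    obtain ⟨i, hi⟩ := σ.surjective (Sum.inr b)
    rcases i with a | b'
    · exact ⟨(a, b), by simpa using hi, rfl⟩
    · have := hpos _ _ hi
      simp only [D, Matrix.fromBlocks_apply₂₂, Matrix.diagonal_apply] at this
      split_ifs at this with h
      · subst h
        simp [hb, div_self hη.ne'] at this
      · exact absurd this (lt_irrefl _)
  · refine le_trans (le_of_eq ?_) hσc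
    simp only [cost]
    rw [Finset.sum_filter, Fintype.sum_prod_type]
    simp
  · rintro ⟨a, b⟩ hx
    simp only [Finset.mem_filter, Finset.mem_univ, true_and] at hx
    have := hpos _ _ hx
    simp only [D, Matrix.fromBlocks_apply₁₂, Matrix.of_apply] at this
    exact (div_pos_iff_of_pos_right hη).1 this
end

section
/- Let A and B be finite sets, let η ≥ 1 be a natural number, and let E : A × B → ℕ be edge multiplicities of a bipartite multigraph such that every a ∈ A has degree Σ_{b} E(a,b) ≤ η and every b ∈ B has degree Σ_{a} E(a,b) ≤ η. Then there exists M : A × B → ℕ with M(a,b) ≤ E(a,b) for all (a,b), Σ_b M(a,b) ≤ 1 for every a ∈ A, Σ_a M(a,b) ≤ 1 for every b ∈ B, and such that every vertex of degree exactly η has M-incidence sum exactly 1. -/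
open Finset in
open scoped Classical in
theorem regular_nat_perm {n : Type*} [Fintype n] (s : ℕ) (hs : 0 < s) (M : n → n → ℕ)
    (h1 : ∀ i, ∑ j, M i j = s) (h2 : ∀ j, ∑ i, M i j = s) :
    ∃ g : n → n, Function.Bijective g ∧ ∀ i, M i (g i) ≠ 0 := by
  let f (i : n) : Finset n := {j | M i j ≠ 0}
  have hf (A : Finset n) : #A ≤ #(A.biUnion f) := by
    have (i : _) : ∑ j ∈ f i, M i j = s := by simp [f, sum_subset (filter_subset _ _), h1]
    have h₁ : ∑ i ∈ A, ∑ j ∈ f i, M i j = #A * s := by simp [this]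
    have h₂ : ∑ i, ∑ j ∈ A.biUnion f, M i j = #(A.biUnion f) * s := by
      simp [sum_comm (t := A.biUnion f), h2]
    suffices #A * s ≤ #(A.biUnion f) * s by exact le_of_mul_le_mul_right this hs
    rw [← h₁, ← h₂]
    trans ∑ i ∈ A, ∑ j ∈ A.biUnion f, M i j
    · refine sum_le_sum fun i hi => ?_
      exact sum_le_sum_of_subset_of_nonneg (subset_biUnion_of_mem f hi) (by simp)
    · exact sum_le_sum_of_subset_of_nonneg (by simp) fun _ _ _ => Nat.zero_le _
  obtain ⟨g, hg, hg'⟩ := (all_card_le_biUnion_card_iff_exists_injective f).1 hf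
  rw [Finite.injective_iff_bijective] at hg
  exact ⟨g, hg, fun i => by simpa [f] using hg' i⟩

open Finset in
/-- In a bipartite multigraph with maximum degree η there is a matching
covering every vertex of degree exactly η (preprocessing claim). -/
theorem multigraph_matching_covers_max_degree {A B : Type*} [Fintype A] [Fintype B]
    (η : ℕ) (hη : 1 ≤ η) (E : A → B → ℕ)
    (hA : ∀ a, (∑ b, E a b) ≤ η) (hB : ∀ b, (∑ a, E a b) ≤ η) :
    ∃ M : A → B → ℕ,
      (∀ a b, M a b ≤ E a b) ∧
      (∀ a, (∑ b, M a b) ≤ 1) ∧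
      (∀ b, (∑ a, M a b) ≤ 1) ∧
      (∀ a, (∑ b, E a b) = η → (∑ b, M a b) = 1) ∧
      (∀ b, (∑ a, E a b) = η → (∑ a, M a b) = 1) := by
  classical
  let N : A ⊕ B → A ⊕ B → ℕ := fun i j => match i, j with
    | .inl a, .inl a' => if a = a' then η - ∑ b, E a b else 0
    | .inl a, .inr b => E a b
    | .inr b, .inl a => E a b
    | .inr b, .inr b' => if b = b' then η - ∑ a, E a b else 0
  obtain ⟨g, hg, hN⟩ := regular_nat_perm η hη N
    (by
      rintro (a | b)
      · have := hA a
        simp [N]; omega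
      · have := hB b
        simp [N]; omega)
    (by
      rintro (a | b)
      · have := hA a
        simp [N]; omega
      · have := hB b
        simp [N]; omega)
  have key1 : ∀ a b, g (.inl a) = .inr b →
      (∑ b', if g (.inl a) = .inr b' then 1 else 0) = 1 := by
    intro a b h
    simp [h]
  have key2 : ∀ a b, g (.inl a) = .inr b →
      (∑ a', if g (.inl a') = .inr b then 1 else 0) = 1 := by
    intro a b h
    have : ∀ a', g (.inl a') = .inr b ↔ a' = a := fun a' => by
      rw [← h, hg.1.eq_iff, Sum.inl.injEq]
    simp [this]
  refine ⟨fun a b => if g (.inl a) = .inr b then 1 else 0, ?_, ?_, ?_, ?_, ?_⟩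
  · intro a b
    dsimp only
    split_ifs with h
    · have := hN (.inl a)
      rw [h] at this
      exact Nat.one_le_iff_ne_zero.2 this
    · exact Nat.zero_le _
  · intro a
    by_cases h : ∃ b, g (.inl a) = .inr b
    · obtain ⟨b, h⟩ := h
      exact (key1 a b h).le
    · push Not at h
      simp [h]
  · intro b
    by_cases h : ∃ a, g (.inl a) = .inr b
    · obtain ⟨a, h⟩ := h
      exact (key2 a b h).le
    · push Not at h
      simp [h]
  · intro a ha
    have h0 := hN (.inl a)
    rcases h : g (.inl a) with a' | b
    · rw [h] at h0
      simp [N, ha] at h0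
    · simpa [h] using key1 a b h
  · intro b hb
    obtain ⟨i, hi⟩ := hg.2 (.inr b)
    have h0 := hN i
    rw [hi] at h0
    rcases i with a | b'
    · exact key2 a b hi
    · exfalso
      apply h0
      simp only [N]
      split_ifs with h
      · subst h; omega
      · rfl
end

section
/- Let α be a finite type and let f : α → Option α be a partial map that is injective where defined, i.e. whenever f a = some c and f b = some c then a = b. Extend f to g : Option α → Option α by g none = none and g (some a) = f a. Let e₀, e₁ ∈ α be distinct elements, neither of which is in the image of f (no a satisfies f a = some e₀ or f a = some e₁). Then the orbits of e₀ and e₁ under g are disjoint: for all natural numbers m, n and every x ∈ α, it is not the case that both g^[m] (some e₀) = some x and g^[n] (some e₁) = some x. -/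
/-- Orbits of an injective partial map started at distinct elements outside its
image are disjoint (second part of Lemma 8). -/
theorem orbits_disjoint_partial_map {α : Type*} [Fintype α] (f : α → Option α)
    (hinj : ∀ a b c, f a = some c → f b = some c → a = b)
    (e₀ e₁ : α) (hne : e₀ ≠ e₁)
    (h₀ : ∀ a, f a ≠ some e₀) (h₁ : ∀ a, f a ≠ some e₁) :
    ∀ m n : ℕ, ∀ x : α,
      ¬((fun o => Option.bind o f)^[m] (some e₀) = some x ∧
        (fun o => Option.bind o f)^[n] (some e₁) = some x) := by
  intro m
  induction m with
  | zero =>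
    rintro n x ⟨hm, hn⟩
    cases n with
    | zero =>
      simp only [Function.iterate_zero, id_eq, Option.some.injEq] at hm hn
      exact hne (hm.trans hn.symm)
    | succ n =>
      simp only [Function.iterate_zero, id_eq, Option.some.injEq] at hm
      rw [Function.iterate_succ_apply'] at hn
      obtain ⟨b, _, hb⟩ := Option.bind_eq_some_iff.mp hn
      exact h₀ b (hm ▸ hb)
  | succ m ih =>
    rintro n x ⟨hm, hn⟩
    rw [Function.iterate_succ_apply'] at hm
    obtain ⟨a, ha, hax⟩ := Option.bind_eq_some_iff.mp hm
    cases n with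
    | zero =>
      simp only [Function.iterate_zero, id_eq, Option.some.injEq] at hn
      exact h₁ a (hn ▸ hax)
    | succ n =>
      rw [Function.iterate_succ_apply'] at hn
      obtain ⟨b, hb, hbx⟩ := Option.bind_eq_some_iff.mp hn
      have hab := hinj a b x hax hbx
      subst hab
      exact ih n a ⟨ha, hb⟩
end

section
/- Let (X, dist) be a metric space, let I be a finite index set, let c : I → X be client positions, let L : I → X, let B ⊆ I, let p ≥ 1 be a natural number, and let 0 < ε ≤ 1/2. Define moved client positions c' : I → X by c'(i) = L(i) if i ∈ B and c'(i) = c(i) otherwise. Then for every assignment μ : I → X: Σ_{i ∈ I} dist(c(i), μ(i))^p ≤ (1+3ε) · Σ_{i ∈ I} dist(c'(i), μ(i))^p + (1 + (p+1)/ε)^p · Σ_{i ∈ B} dist(c(i), L(i))^p. -/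
theorem powered_triangle_aux (p : ℕ) (ε x y : ℝ) (hε : 0 < ε) (hε' : ε ≤ 1/2)
    (hx : 0 ≤ x) (hy : 0 ≤ y) :
    (x + y) ^ p ≤ (1 + 3 * ε) * y ^ p + (1 + ((p : ℝ) + 1) / ε) ^ p * x ^ p := by
  have hp1 : (0 : ℝ) < (p : ℝ) + 1 := by positivity
  rcases le_total (((p : ℝ) + 1) * x) (ε * y) with h | h
  · have h1 : x + y ≤ (1 + ε / ((p : ℝ) + 1)) * y := by
      have : x ≤ ε * y / ((p : ℝ) + 1) := by
        rw [le_div_iff₀ hp1]; linarith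
      have e : (1 + ε / ((p : ℝ) + 1)) * y = y + ε * y / ((p : ℝ) + 1) := by ring
      linarith
    have h2 : (1 + ε / ((p : ℝ) + 1)) ^ p ≤ 1 + 3 * ε := by
      have a : 1 + ε / ((p : ℝ) + 1) ≤ Real.exp (ε / ((p : ℝ) + 1)) := by
        linarith [Real.add_one_le_exp (ε / ((p : ℝ) + 1))]
      have b : (1 + ε / ((p : ℝ) + 1)) ^ p ≤ Real.exp (p * (ε / ((p : ℝ) + 1))) := by
        rw [Real.exp_nat_mul]
        exact pow_le_pow_left₀ (by positivity) a p
      have d : (p : ℝ) * (ε / ((p : ℝ) + 1)) ≤ ε := by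
        rw [← mul_div_assoc, div_le_iff₀ hp1]; nlinarith
      have e := Real.exp_le_exp.mpr d
      have f := Real.abs_exp_sub_one_sub_id_le (x := ε) (by rw [abs_of_pos hε]; linarith)
      have g := (abs_le.mp f).2
      nlinarith
    calc (x + y) ^ p ≤ ((1 + ε / ((p : ℝ) + 1)) * y) ^ p :=
          pow_le_pow_left₀ (by positivity) h1 p
      _ = (1 + ε / ((p : ℝ) + 1)) ^ p * y ^ p := mul_pow _ _ _
      _ ≤ (1 + 3 * ε) * y ^ p := mul_le_mul_of_nonneg_right h2 (by positivity)
      _ ≤ _ := le_add_of_nonneg_right (by positivity)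
  · have h1 : x + y ≤ (1 + ((p : ℝ) + 1) / ε) * x := by
      have : y ≤ ((p : ℝ) + 1) * x / ε := by
        rw [le_div_iff₀ hε]; linarith
      have e : (1 + ((p : ℝ) + 1) / ε) * x = x + ((p : ℝ) + 1) * x / ε := by ring
      linarith
    calc (x + y) ^ p ≤ ((1 + ((p : ℝ) + 1) / ε) * x) ^ p :=
          pow_le_pow_left₀ (by positivity) h1 p
      _ = (1 + ((p : ℝ) + 1) / ε) ^ p * x ^ p := mul_pow _ _ _
      _ ≤ _ := le_add_of_nonneg_left (by positivity)

open Finset in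
/-- First cost-distortion direction for moving badly cut clients (Equation (1)
in the proof of Lemma 7). -/
theorem moved_instance_cost_lower {X : Type*} [MetricSpace X] {I : Type*} [Fintype I]
    [DecidableEq I] (c L : I → X) (B : Finset I) (p : ℕ) (hp : 1 ≤ p)
    (ε : ℝ) (hε : 0 < ε) (hε' : ε ≤ 1/2) (μ : I → X) :
    (∑ i, dist (c i) (μ i) ^ p) ≤
      (1 + 3 * ε) * (∑ i, dist ((fun j => if j ∈ B then L j else c j) i) (μ i) ^ p)
      + (1 + ((p : ℝ) + 1) / ε) ^ p * (∑ i ∈ B, dist (c i) (L i) ^ p) := by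
  have hB : (∑ i ∈ B, dist (c i) (L i) ^ p)
      = ∑ i, if i ∈ B then dist (c i) (L i) ^ p else 0 := by
    rw [Finset.sum_ite_mem, Finset.univ_inter]
  rw [hB, Finset.mul_sum, Finset.mul_sum, ← Finset.sum_add_distrib]
  refine Finset.sum_le_sum fun i _ => ?_
  by_cases h : i ∈ B
  · simp only [h, if_true]
    exact (pow_le_pow_left₀ dist_nonneg (dist_triangle (c i) (L i) (μ i)) p).trans
      (powered_triangle_aux p ε _ _ hε hε' dist_nonneg dist_nonneg)
  · simp only [h, if_false, mul_zero, add_zero]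
    have : 0 ≤ dist (c i) (μ i) ^ p := by positivity
    nlinarith
end

section
/- Let (X, dist) be a metric space, let I be a finite index set, let c : I → X be client positions, let L : I → X, let B ⊆ I, let p ≥ 1 be a natural number, and let 0 < ε ≤ 1/2. Define moved client positions c' : I → X by c'(i) = L(i) if i ∈ B and c'(i) = c(i) otherwise. Then for every assignment μ : I → X: Σ_{i ∈ I} dist(c'(i), μ(i))^p ≤ (1+3ε) · Σ_{i ∈ I} dist(c(i), μ(i))^p + (1 + (p+1)/ε)^p · Σ_{i ∈ B} dist(c(i), L(i))^p. -/
theorem aux_pow (a b ε : ℝ) (p : ℕ) (ha : 0 ≤ a) (hb : 0 ≤ b) (hε : 0 < ε) (hε' : ε ≤ 1/2) :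
    (a + b) ^ p ≤ (1 + 3 * ε) * a ^ p + (1 + ((p : ℝ) + 1) / ε) ^ p * b ^ p := by
  have hp1 : (0 : ℝ) < (p : ℝ) + 1 := by positivity
  rcases le_total (b * ((p : ℝ) + 1)) (ε * a) with h | h
  · have h1 : a + b ≤ (1 + ε / ((p : ℝ) + 1)) * a := by
      have : b ≤ ε * a / ((p : ℝ) + 1) := by rwa [le_div_iff₀ hp1]
      calc a + b ≤ a + ε * a / ((p : ℝ) + 1) := by linarith
        _ = _ := by ring
    have h2 : (1 + ε / ((p : ℝ) + 1)) ^ p ≤ 1 + 3 * ε := by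
      have e1 : 1 + ε / ((p : ℝ) + 1) ≤ Real.exp (ε / ((p : ℝ) + 1)) := by
        linarith [Real.add_one_le_exp (ε / ((p : ℝ) + 1))]
      have e2 : (p : ℝ) * (ε / ((p : ℝ) + 1)) ≤ ε := by
        rw [← mul_div_assoc, div_le_iff₀ hp1]; nlinarith
      have e3 := (abs_le.1 (Real.abs_exp_sub_one_sub_id_le (x := ε)
        (by rw [abs_of_pos hε]; linarith))).2
      calc (1 + ε / ((p : ℝ) + 1)) ^ p ≤ Real.exp (ε / ((p : ℝ) + 1)) ^ p :=
            pow_le_pow_left₀ (by positivity) e1 p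
        _ = Real.exp ((p : ℝ) * (ε / ((p : ℝ) + 1))) := by rw [Real.exp_nat_mul]
        _ ≤ Real.exp ε := Real.exp_le_exp.2 e2
        _ ≤ 1 + 3 * ε := by nlinarith
    have h3 : 0 ≤ (1 + ((p : ℝ) + 1) / ε) ^ p * b ^ p := by positivity
    calc (a + b) ^ p ≤ ((1 + ε / ((p : ℝ) + 1)) * a) ^ p :=
          pow_le_pow_left₀ (by positivity) h1 p
      _ = (1 + ε / ((p : ℝ) + 1)) ^ p * a ^ p := mul_pow _ _ _
      _ ≤ (1 + 3 * ε) * a ^ p := mul_le_mul_of_nonneg_right h2 (by positivity)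
      _ ≤ _ := by linarith
  · have h1 : a + b ≤ (1 + ((p : ℝ) + 1) / ε) * b := by
      have : a ≤ b * ((p : ℝ) + 1) / ε := by rw [le_div_iff₀ hε]; linarith
      calc a + b ≤ b * ((p : ℝ) + 1) / ε + b := by linarith
        _ = _ := by ring
    have h3 : 0 ≤ (1 + 3 * ε) * a ^ p := by positivity
    calc (a + b) ^ p ≤ ((1 + ((p : ℝ) + 1) / ε) * b) ^ p :=
          pow_le_pow_left₀ (by positivity) h1 p
      _ = (1 + ((p : ℝ) + 1) / ε) ^ p * b ^ p := mul_pow _ _ _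
      _ ≤ _ := by linarith


open Finset in
/-- Second cost-distortion direction for moving badly cut clients (Equation (2)
in the proof of Lemma 7). -/
theorem moved_instance_cost_upper {X : Type*} [MetricSpace X] {I : Type*} [Fintype I]
    [DecidableEq I] (c L : I → X) (B : Finset I) (p : ℕ) (hp : 1 ≤ p)
    (ε : ℝ) (hε : 0 < ε) (hε' : ε ≤ 1/2) (μ : I → X) :
    (∑ i, dist ((fun j => if j ∈ B then L j else c j) i) (μ i) ^ p) ≤
      (1 + 3 * ε) * (∑ i, dist (c i) (μ i) ^ p)
      + (1 + ((p : ℝ) + 1) / ε) ^ p * (∑ i ∈ B, dist (c i) (L i) ^ p) := by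

  have hB : ∑ i ∈ B, dist (c i) (L i) ^ p = ∑ i, if i ∈ B then dist (c i) (L i) ^ p else 0 := by
    simp
  rw [hB, Finset.mul_sum, Finset.mul_sum, ← Finset.sum_add_distrib]
  refine Finset.sum_le_sum fun i _ => ?_
  by_cases hi : i ∈ B
  · simp only [hi, if_true]
    refine le_trans (pow_le_pow_left₀ dist_nonneg ?_ p)
      (aux_pow (dist (c i) (μ i)) (dist (c i) (L i)) ε p dist_nonneg dist_nonneg hε hε')
    have := dist_triangle (L i) (c i) (μ i)
    rw [dist_comm (L i) (c i)] at this
    linarith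
  · simp only [hi, if_false]
    have : 0 ≤ dist (c i) (μ i) ^ p := by positivity
    nlinarith
end
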